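/- Let h ∈ ℝ[x₁,…,x_m] be hyperbolic with respect to e ∈ Γ₊₊, let v₁,…,vₙ ∈ Γ₊ with rank_h(vᵢ) ≤ 1 for all i, and let ξ₁,…,ξₙ be independent real random variables with finite supports, E[ξᵢ] = μᵢ and Var[ξᵢ] = τᵢ². Then for any Q ∈ ℝ^m, E_{ξ₁,…,ξₙ}[ h(xe − (Q + Σ_{i=1}^n (ξᵢ − μᵢ)vᵢ)) · h(xe + (Q + Σ_{i=1}^n (ξᵢ − μᵢ)vᵢ)) ] = ∏_{i=1}^n (1 − (1/2)∂²/∂zᵢ²)|_{z=0} [ h(xe − Q + Σ_{i=1}^n zᵢτᵢvᵢ) · h(xe + Q + Σ_{i=1}^n zᵢτᵢvᵢ) ], and moreover this is a real-rooted polynomial in x. -/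

import Mathlib

open MvPolynomial Finset
open scoped Classical

noncomputable section

/-- `h` is homogeneous of degree `d`, positive at `e`, and for every `x` the univariate
polynomial `t ↦ h (t • e - x)` factors with real roots `lam x 1 ≥ … ≥ lam x d`
(the hyperbolic eigenvalues of `x`). -/
def IsHyperbolic {m d : ℕ} (h : MvPolynomial (Fin m) ℝ) (e : Fin m → ℝ)
    (lam : (Fin m → ℝ) → Fin d → ℝ) : Prop :=
  h.IsHomogeneous d ∧ 0 < eval e h ∧ (∀ x, Antitone (lam x)) ∧
    ∀ x : Fin m → ℝ, ∀ t : ℝ,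
      eval (t • e - x) h = eval e h * ∏ i, (t - lam x i)

/-- hyperbolic trace: the sum of the hyperbolic eigenvalues. -/
def htrace {m d : ℕ} (lam : (Fin m → ℝ) → Fin d → ℝ) (x : Fin m → ℝ) : ℝ :=
  ∑ i, lam x i

/-- hyperbolic rank: the number of nonzero hyperbolic eigenvalues. -/
def hrank {m d : ℕ} (lam : (Fin m → ℝ) → Fin d → ℝ) (x : Fin m → ℝ) : ℕ :=
  Nat.card {i : Fin d // lam x i ≠ 0}

/-- hyperbolic norm: the largest absolute value of a hyperbolic eigenvalue. -/
def hnorm {m d : ℕ} (lam : (Fin m → ℝ) → Fin d → ℝ) (x : Fin m → ℝ) : ℝ :=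
  ⨆ i, |lam x i|

/-- closed hyperbolicity cone: all hyperbolic eigenvalues nonnegative. -/
def InCone {m d : ℕ} (lam : (Fin m → ℝ) → Fin d → ℝ) (x : Fin m → ℝ) : Prop :=
  ∀ i, 0 ≤ lam x i

/-- open hyperbolicity cone: all hyperbolic eigenvalues positive. -/
def InOpenCone {m d : ℕ} (lam : (Fin m → ℝ) → Fin d → ℝ) (x : Fin m → ℝ) : Prop :=
  ∀ i, 0 < lam x i

/-- A univariate real polynomial is real-rooted: all complex roots are real. -/
def RealRooted (q : Polynomial ℝ) : Prop :=
  ∀ z : ℂ, Polynomial.aeval z q = 0 → z.im = 0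

/-- the `(n+1)`-variate polynomial `h (x • e + Q + ∑ i, z i • w i)` in variables
`x = X 0` and `z i = X i.succ`. -/
def substPoly {m n : ℕ} (h : MvPolynomial (Fin m) ℝ) (e Q : Fin m → ℝ)
    (w : Fin n → Fin m → ℝ) : MvPolynomial (Fin (n + 1)) ℝ :=
  aeval (fun j : Fin m =>
    X (0 : Fin (n + 1)) * C (e j) + C (Q j) + ∑ i : Fin n, X i.succ * C (w i j)) h

/-- apply the operator `∏ i (1 - (1/2) ∂²_{z i})` to a polynomial in variables
`x = X 0, z 1 = X 1, …, z n = X n`. -/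
def opAll {n : ℕ} (P : MvPolynomial (Fin (n + 1)) ℝ) : MvPolynomial (Fin (n + 1)) ℝ :=
  (List.finRange n).foldl
    (fun Q i => Q - C (1 / 2 : ℝ) * pderiv i.succ (pderiv i.succ Q)) P

/-- `∏ i (1 - (1/2) ∂²_{z i}) [h(xe - Q + ∑ z i • w i) · h(xe + Q + ∑ z i • w i)]`. -/
def mixedPoly {m n : ℕ} (h : MvPolynomial (Fin m) ℝ) (e Q : Fin m → ℝ)
    (w : Fin n → Fin m → ℝ) : MvPolynomial (Fin (n + 1)) ℝ :=
  opAll (substPoly h e (-Q) w * substPoly h e Q w)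

/-- restrict a polynomial in `x, z 1, …, z n` to `z = 0`, as a univariate polynomial in `x`. -/
def toUni {n : ℕ} (P : MvPolynomial (Fin (n + 1)) ℝ) : Polynomial ℝ :=
  aeval (Fin.cons Polynomial.X fun _ => (0 : Polynomial ℝ)) P


section LineRestriction

variable {σ R : Type*} [CommRing R]

/-- The restriction `t ↦ a (y + t • v)` of a polynomial to a line. -/
def linePoly (a : MvPolynomial σ R) (y v : σ → R) : Polynomial R :=
  aeval (fun j => Polynomial.C (y j) + Polynomial.C (v j) * Polynomial.X) a

/-- The derivative of a polynomial in the direction `v`. -/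
def dirDeriv (v : σ → R) : Derivation R (MvPolynomial σ R) (MvPolynomial σ R) :=
  mkDerivation R fun j => C (v j)

theorem eval_linePoly (a : MvPolynomial σ R) (y v : σ → R) (t : R) :
    (linePoly a y v).eval t = eval (y + t • v) a := by
  unfold linePoly
  induction a using MvPolynomial.induction_on with
  | C r => simp
  | add p q hp hq => simp [hp, hq]
  | mul_X p j hp =>
    simp [hp]
    ring

theorem derivative_linePoly (a : MvPolynomial σ R) (y v : σ → R) :
    (linePoly a y v).derivative = linePoly (dirDeriv v a) y v := by
  unfold linePoly
  induction a using MvPolynomial.induction_on with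
  | C r => simp [dirDeriv]
  | add p q hp hq => simp [hp, hq]
  | mul_X p j hp =>
    simp only [map_mul, aeval_X, Polynomial.derivative_mul, hp, Derivation.leibniz, map_add,
      smul_eq_mul]
    simp [dirDeriv, mkDerivation_X]
    ring

theorem dirDeriv_comm (v w : σ → R) (a : MvPolynomial σ R) :
    dirDeriv v (dirDeriv w a) = dirDeriv w (dirDeriv v a) := by
  have h : ⁅(dirDeriv v : Derivation R (MvPolynomial σ R) (MvPolynomial σ R)), dirDeriv w⁆ = 0 :=
    derivation_ext fun i => by simp [Derivation.commutator_apply, dirDeriv, mkDerivation_X]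
  simpa [Derivation.commutator_apply, sub_eq_zero] using congrArg (fun D => D a) h

theorem dirDeriv_smul (c : R) (v : σ → R) (a : MvPolynomial σ R) :
    dirDeriv (c • v) a = c • dirDeriv v a := by
  have h : (dirDeriv (c • v) : Derivation R (MvPolynomial σ R) (MvPolynomial σ R)) =
      c • dirDeriv v :=
    derivation_ext fun i => by simp [dirDeriv, mkDerivation_X, MvPolynomial.smul_eq_C_mul]
  rw [h, Derivation.smul_apply]

theorem dirDeriv_single [DecidableEq σ] (i : σ) (a : MvPolynomial σ R) :
    dirDeriv (Pi.single i 1) a = pderiv i a := by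
  have h : (dirDeriv (Pi.single i 1) : Derivation R (MvPolynomial σ R) (MvPolynomial σ R)) =
      pderiv i :=
    derivation_ext fun j => by
      rw [dirDeriv, mkDerivation_X, pderiv_X]
      by_cases hij : i = j
      · subst hij; simp
      · simp [Ne.symm hij]
  rw [h]

theorem eval_add_smul_of_dirDeriv_eq_zero [IsDomain R] [CharZero R] {a : MvPolynomial σ R}
    {v : σ → R} (ha : dirDeriv v (dirDeriv v a) = 0) (y : σ → R) (t : R) :
    eval (y + t • v) a = eval y a + t * eval y (dirDeriv v a) := by
  have h1 : (linePoly (dirDeriv v a) y v).derivative = 0 := by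
    rw [derivative_linePoly, ha]; simp [linePoly]
  have h2 : linePoly (dirDeriv v a) y v = Polynomial.C (eval y (dirDeriv v a)) := by
    rw [Polynomial.eq_C_of_derivative_eq_zero h1]
    congr 1
    rw [Polynomial.coeff_zero_eq_eval_zero, eval_linePoly]; simp
  have h3 : linePoly a y v =
      Polynomial.C (eval y a) + Polynomial.X * Polynomial.C (eval y (dirDeriv v a)) := by
    have h4 : (linePoly a y v - Polynomial.X * Polynomial.C (eval y (dirDeriv v a))).derivative
        = 0 := by
      simp [derivative_linePoly, h2]
    have h5 := Polynomial.eq_C_of_derivative_eq_zero h4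
    rw [sub_eq_iff_eq_add] at h5
    rw [h5, Polynomial.coeff_zero_eq_eval_zero]
    simp [eval_linePoly]
  rw [← eval_linePoly, h3]
  simp [mul_comm t]

theorem dirDeriv_dirDeriv_eq_zero [IsDomain R] [Infinite R] {a : MvPolynomial σ R}
    {v : σ → R} (ha : ∀ y, (linePoly a y v).natDegree ≤ 1) :
    dirDeriv v (dirDeriv v a) = 0 := by
  refine MvPolynomial.funext fun y => ?_
  have h : (linePoly a y v).derivative.derivative = 0 := by
    rw [Polynomial.eq_X_add_C_of_natDegree_le_one (ha y)]; simp
  rw [derivative_linePoly, derivative_linePoly] at h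
  simpa [eval_linePoly] using congrArg (Polynomial.eval 0) h

theorem MvPolynomial.IsHomogeneous.eval_smul_arg {a : MvPolynomial σ R} {d : ℕ}
    (ha : a.IsHomogeneous d) (c : R) (x : σ → R) : eval (c • x) a = c ^ d * eval x a := by
  rw [eval_eq, eval_eq, Finset.mul_sum]
  refine Finset.sum_congr rfl fun k hk => ?_
  have hd : ∑ i ∈ k.support, k i = d := by
    rw [← ha (mem_support_iff.1 hk)]; simp [Finsupp.weight_apply, Finsupp.sum]
  simp only [Pi.smul_apply, smul_eq_mul, mul_pow, Finset.prod_mul_distrib, Finset.prod_pow_eq_pow_sum,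
    hd]
  ring

theorem natDegree_coeff_prod_linear (y v : σ → R) (k : σ → ℕ) (s : Finset σ) :
    (∏ i ∈ s, (Polynomial.C (y i) + Polynomial.C (v i) * Polynomial.X) ^ k i).natDegree
        ≤ ∑ i ∈ s, k i ∧
      (∏ i ∈ s, (Polynomial.C (y i) + Polynomial.C (v i) * Polynomial.X) ^ k i).coeff
        (∑ i ∈ s, k i) = ∏ i ∈ s, v i ^ k i := by
  induction s using Finset.induction_on with
  | empty => simp
  | insert j s hj ih =>
    have hl : (Polynomial.C (y j) + Polynomial.C (v j) * Polynomial.X).natDegree ≤ 1 := by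
      compute_degree
    have hp : ((Polynomial.C (y j) + Polynomial.C (v j) * Polynomial.X) ^ k j).natDegree ≤ k j := by
      simpa using Polynomial.natDegree_pow_le_of_le (k j) hl
    have hc : ((Polynomial.C (y j) + Polynomial.C (v j) * Polynomial.X) ^ k j).coeff (k j) =
        v j ^ k j := by
      have := Polynomial.coeff_pow_of_natDegree_le (m := k j) hl
      simpa using this
    rw [Finset.prod_insert hj, Finset.sum_insert hj, Finset.prod_insert hj]
    exact ⟨Polynomial.natDegree_mul_le_of_le hp ih.1, by
      rw [Polynomial.coeff_mul_add_eq_of_natDegree_le hp ih.1, hc, ih.2]⟩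

theorem natDegree_coeff_linePoly {a : MvPolynomial σ R} {d : ℕ} (ha : a.IsHomogeneous d)
    (y v : σ → R) : (linePoly a y v).natDegree ≤ d ∧ (linePoly a y v).coeff d = eval v a := by
  have key : ∀ k ∈ a.support, ∑ i ∈ k.support, k i = d := fun k hk => by
    rw [← ha (mem_support_iff.1 hk)]; simp [Finsupp.weight_apply, Finsupp.sum]
  rw [linePoly, aeval_def, eval₂_eq, eval_eq]
  constructor
  · refine Polynomial.natDegree_sum_le_of_forall_le _ _ fun k hk => ?_
    have := (natDegree_coeff_prod_linear y v k k.support).1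
    rw [key k hk] at this
    exact (Polynomial.natDegree_C_mul_le _ _).trans this
  · rw [Polynomial.finsetSum_coeff]
    refine Finset.sum_congr rfl fun k hk => ?_
    have := (natDegree_coeff_prod_linear y v k k.support).2
    rw [key k hk] at this
    rw [Polynomial.algebraMap_eq, Polynomial.coeff_C_mul, this]

end LineRestriction

section Complexification

variable {σ : Type*}

/-- A real vector regarded as a complex vector. -/
def complexify (v : σ → ℝ) : σ → ℂ := fun j => (v j : ℂ)

theorem complexify_add (v w : σ → ℝ) : complexify (v + w) = complexify v + complexify w := by
  ext; simp [complexify]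

theorem complexify_sub (v w : σ → ℝ) : complexify (v - w) = complexify v - complexify w := by
  ext; simp [complexify]

theorem complexify_smul (c : ℝ) (v : σ → ℝ) : complexify (c • v) = (c : ℂ) • complexify v := by
  ext; simp [complexify]

theorem eval_complexify (a : MvPolynomial σ ℝ) (v : σ → ℝ) :
    eval (complexify v) (map Complex.ofRealHom a) = (eval v a : ℂ) := by
  rw [eval_map, ← Complex.ofRealHom_eq_coe, ← eval₂_id, eval₂_comp_left]
  rfl

end Complexification

theorem IsHyperbolic.eval_complex_line {m d : ℕ} {h : MvPolynomial (Fin m) ℝ} {e : Fin m → ℝ}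
    {lam : (Fin m → ℝ) → Fin d → ℝ} (hh : IsHyperbolic h e lam) (x : Fin m → ℝ) (s : ℂ) :
    eval (s • complexify e - complexify x) (map Complex.ofRealHom h) =
      (eval e h : ℂ) * ∏ i, (s - lam x i) := by
  have key : linePoly (map Complex.ofRealHom h) (-complexify x) (complexify e) =
      Polynomial.C (eval e h : ℂ) * ∏ i, (Polynomial.X - Polynomial.C (lam x i : ℂ)) := by
    refine Polynomial.eq_of_infinite_eval_eq _ _
      ((Set.infinite_range_of_injective Complex.ofReal_injective).mono ?_)
    rintro _ ⟨t, rfl⟩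
    have h1 : -complexify x + (t : ℂ) • complexify e = complexify (t • e - x) := by
      rw [complexify_sub, complexify_smul]; ring
    simp only [Set.mem_ofPred_eq, eval_linePoly, h1, eval_complexify, hh.2.2.2]
    simp [Polynomial.eval_prod]
  have := congrArg (Polynomial.eval s) key
  rw [eval_linePoly] at this
  rw [sub_eq_neg_add, this]
  simp [Polynomial.eval_prod]

theorem IsHyperbolic.eval_complex_plane {m d : ℕ} {h : MvPolynomial (Fin m) ℝ} {e : Fin m → ℝ}
    {lam : (Fin m → ℝ) → Fin d → ℝ} (hh : IsHyperbolic h e lam) (v : Fin m → ℝ) (s t : ℂ) :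
    eval (s • complexify e + t • complexify v) (map Complex.ofRealHom h) =
      (eval e h : ℂ) * ∏ i, (s + t * lam v i) := by
  have hH : (map Complex.ofRealHom h).IsHomogeneous d := hh.1.map _
  by_cases ht : t = 0
  · subst ht
    rw [zero_smul, add_zero, hH.eval_smul_arg, eval_complexify]
    simp [mul_comm]
  · have h1 : s • complexify e + t • complexify v =
        (-t) • ((-s / t) • complexify e - complexify v) := by
      rw [smul_sub, smul_smul]
      have : -t * (-s / t) = s := by field_simp
      rw [this]; simp
    rw [h1, hH.eval_smul_arg, hh.eval_complex_line]
    have h2 : ∀ i, s + t * (lam v i : ℂ) = (-t) * (-s / t - lam v i) := fun i => by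
      field_simp; ring
    simp only [h2, Finset.prod_mul_distrib]
    simp
    ring

/-- If the zeros of `t ↦ H (r • Y + Z + t • u)` never cross the real axis while `r` runs
through `[0, 1]`, and they start in the open lower half-plane, then they end there. -/
theorem eval_ne_zero_of_homotopy {m d : ℕ} {H : MvPolynomial (Fin m) ℂ} (hH : H.IsHomogeneous d)
    {u Y Z : Fin m → ℂ} (hu : eval u H ≠ 0)
    (hreal : ∀ r ∈ Set.Icc (0 : ℝ) 1, ∀ t : ℝ, eval ((r : ℂ) • Y + Z + (t : ℂ) • u) H ≠ 0)
    (h0 : ∀ t : ℂ, 0 ≤ t.im → eval (Z + t • u) H ≠ 0) (t : ℂ) (ht : 0 ≤ t.im) :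
    eval (Y + Z + t • u) H ≠ 0 := by
  have hcont : Continuous fun z : Fin m → ℂ => eval z H := MvPolynomial.continuous_eval H
  have hfc : Continuous fun q : ℝ × ℂ => eval ((q.1 : ℂ) • Y + Z + q.2 • u) H := by
    refine hcont.comp ?_
    fun_prop
  obtain ⟨B, hB⟩ : ∃ B : ℝ, ∀ r ∈ Set.Icc (0 : ℝ) 1, ∀ t : ℂ,
      eval ((r : ℂ) • Y + Z + t • u) H = 0 → ‖t‖ ≤ B := by
    obtain ⟨δ, hδ, hball⟩ := Metric.eventually_nhds_iff.1 (hcont.continuousAt.eventually_ne hu)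
    refine ⟨(‖Y‖ + ‖Z‖) / δ, fun r hr t h => ?_⟩
    by_contra! hlt
    have hn : 0 ≤ (‖Y‖ + ‖Z‖) / δ := by positivity
    have htn : 0 < ‖t‖ := hn.trans_lt hlt
    have ht0 : t ≠ 0 := norm_pos_iff.1 htn
    have h1 : (r : ℂ) • Y + Z + t • u = t • (u + t⁻¹ • ((r : ℂ) • Y + Z)) := by
      rw [smul_add, smul_smul, mul_inv_cancel₀ ht0, one_smul]; ring
    rw [h1, hH.eval_smul_arg] at h
    refine hball (y := u + t⁻¹ • ((r : ℂ) • Y + Z)) ?_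
      ((mul_eq_zero.1 h).resolve_left (pow_ne_zero _ ht0))
    rw [dist_eq_norm, add_sub_cancel_left, norm_smul, norm_inv]
    have h2 : ‖(r : ℂ) • Y + Z‖ ≤ ‖Y‖ + ‖Z‖ := by
      refine (norm_add_le _ _).trans (add_le_add_left ?_ _)
      rw [norm_smul, Complex.norm_real, Real.norm_of_nonneg hr.1]
      exact mul_le_of_le_one_left (norm_nonneg _) hr.2
    rw [div_lt_iff₀ hδ] at hlt
    rw [inv_mul_lt_iff₀ htn]
    exact h2.trans_lt hlt
  let K : Set (ℝ × ℂ) := {q | q ∈ Set.Icc (0 : ℝ) 1 ×ˢ Metric.closedBall (0 : ℂ) B ∧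
    0 ≤ q.2.im ∧ eval ((q.1 : ℂ) • Y + Z + q.2 • u) H = 0}
  have hK : IsCompact K := by
    refine (isCompact_Icc.prod (isCompact_closedBall (0 : ℂ) B)).inter_right ?_
    exact (isClosed_le continuous_const (Complex.continuous_im.comp continuous_snd)).inter
      (isClosed_eq hfc continuous_const)
  let A : Set (Set.Icc (0 : ℝ) 1) :=
    {r | ∃ t : ℂ, 0 ≤ t.im ∧ eval (((r : ℝ) : ℂ) • Y + Z + t • u) H = 0}
  have hA : A = Subtype.val ⁻¹' (Prod.fst '' K) := by
    ext r
    constructor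
    · rintro ⟨t, ht, h⟩
      exact ⟨(r, t), ⟨⟨r.2, by simpa using hB r r.2 t h⟩, ht, h⟩, rfl⟩
    · rintro ⟨⟨r', t⟩, ⟨-, ht, h⟩, hr⟩
      obtain rfl : r' = r := hr
      exact ⟨t, ht, h⟩
  have hclosed : IsClosed A := by
    rw [hA]
    exact (hK.image continuous_fst).isClosed.preimage continuous_subtype_val
  have hopen : IsOpen A := by
    rw [isOpen_iff_mem_nhds]
    rintro r ⟨t, ht, h⟩
    have htpos : 0 < t.im := by
      refine lt_of_le_of_ne ht fun h0 => hreal r r.2 t.re ?_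
      rwa [show ((t.re : ℝ) : ℂ) = t from Complex.ext rfl (by simpa using h0)]
    have hsmall : ∀ᶠ r' : Set.Icc (0 : ℝ) 1 in nhds r,
        ‖eval (((r' : ℝ) : ℂ) • Y + Z + t • u) H‖ < ‖eval u H‖ * t.im ^ d := by
      have hc : Continuous fun r' : Set.Icc (0 : ℝ) 1 =>
          ‖eval (((r' : ℝ) : ℂ) • Y + Z + t • u) H‖ :=
        (hfc.comp (continuous_subtype_val.prodMk continuous_const)).norm
      refine hc.continuousAt.eventually_lt continuousAt_const ?_
      rw [h, norm_zero]
      have := norm_pos_iff.2 hu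
      positivity
    filter_upwards [hsmall] with r' hr'
    by_contra hno
    have hno' : ∀ s : ℂ, eval (((r' : ℝ) : ℂ) • Y + Z + s • u) H = 0 → s.im < 0 := fun s hs => by
      by_contra! hs'
      exact hno ⟨s, hs', hs⟩
    refine hr'.not_ge ?_
    set P := linePoly H (((r' : ℝ) : ℂ) • Y + Z) u with hP
    obtain ⟨hdeg, hco⟩ := natDegree_coeff_linePoly hH (((r' : ℝ) : ℂ) • Y + Z) u
    have hnd : P.natDegree = d :=
      le_antisymm hdeg (Polynomial.le_natDegree_of_ne_zero (by rw [hco]; exact hu))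
    have hsplit := IsAlgClosed.splits P
    have hP0 : P ≠ 0 := by
      rintro h0
      rw [← hP, h0, Polynomial.coeff_zero] at hco
      exact hu hco.symm
    rw [← eval_linePoly, ← hP, hsplit.eval_eq_prod_roots, norm_mul, Polynomial.leadingCoeff, hnd,
      hco]
    refine mul_le_mul_of_nonneg_left ?_ (norm_nonneg _)
    have hcard : P.roots.card = d := by rw [← hsplit.natDegree_eq_card_roots, hnd]
    have hbound : ∀ M : Multiset ℂ, (∀ ρ ∈ M, ρ.im < 0) →
        t.im ^ M.card ≤ ‖(M.map fun ρ => t - ρ).prod‖ := by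
      intro M
      induction M using Multiset.induction_on with
      | empty => simp
      | cons ρ M ih =>
        intro hM
        rw [Multiset.map_cons, Multiset.prod_cons, norm_mul, Multiset.card_cons, pow_succ']
        refine mul_le_mul ?_ (ih fun ρ' h' => hM ρ' (Multiset.mem_cons_of_mem h')) (by positivity)
          (norm_nonneg _)
        have h1 := hM ρ (Multiset.mem_cons_self _ _)
        refine le_trans ?_ (Complex.abs_im_le_norm (t - ρ))
        rw [Complex.sub_im]
        exact le_trans (by linarith) (le_abs_self _)
    rw [← hcard]
    refine hbound _ fun ρ hρ => hno' ρ ?_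
    rw [← eval_linePoly]
    exact (Polynomial.mem_roots hP0).1 hρ
  have hempty : A = ∅ := by
    rcases isClopen_iff.1 ⟨hclosed, hopen⟩ with h | h
    · exact h
    · exfalso
      obtain ⟨s, hs, hs0⟩ : (⟨0, by simp⟩ : Set.Icc (0 : ℝ) 1) ∈ A := h ▸ Set.mem_univ _
      exact h0 s hs (by simpa using hs0)
  intro hzero
  have : (⟨1, by simp⟩ : Set.Icc (0 : ℝ) 1) ∈ A := ⟨t, ht, by simpa using hzero⟩
  rw [hempty] at this
  exact this

/-- A hyperbolic polynomial does not vanish at points whose imaginary part is a positive multiple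
of the hyperbolicity direction plus an element of the cone spanned by cone vectors. -/
theorem IsHyperbolic.eval_ne_zero {m d : ℕ} {h : MvPolynomial (Fin m) ℝ} {e : Fin m → ℝ}
    {lam : (Fin m → ℝ) → Fin d → ℝ} (hh : IsHyperbolic h e lam) {ι : Type*} {v : ι → Fin m → ℝ}
    (hv : ∀ i, InCone lam (v i)) (T : Finset ι) (y : Fin m → ℝ) (s : ℂ) (hs : 0 < s.im)
    (t : ι → ℂ) (ht : ∀ i, 0 ≤ (t i).im) :
    eval (complexify y + s • complexify e + ∑ i ∈ T, t i • complexify (v i))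
      (map Complex.ofRealHom h) ≠ 0 := by
  have he : (eval e h : ℂ) ≠ 0 := Complex.ofReal_ne_zero.2 hh.2.1.ne'
  induction T using Finset.induction_on generalizing y s t with
  | empty =>
    have h1 : complexify y + s • complexify e = s • complexify e - complexify (-y) := by
      ext; simp [complexify]; ring
    rw [Finset.sum_empty, add_zero, h1, hh.eval_complex_line]
    refine mul_ne_zero he (Finset.prod_ne_zero_iff.2 fun i _ h0 => ?_)
    rw [sub_eq_zero.1 h0] at hs
    simp at hs
  | insert j T hj ih =>
    obtain ⟨ε, hε, hεs⟩ : ∃ ε : ℝ, 0 < ε ∧ ε * (t j).im < s.im := by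
      refine ⟨s.im / ((t j).im + 1), div_pos hs (by linarith [ht j]), ?_⟩
      rw [div_mul_eq_mul_div, div_lt_iff₀ (by linarith [ht j])]
      nlinarith
    set s' : ℂ := s - ε * t j with hs'
    have hs'pos : 0 < s'.im := by simp [hs', hεs]
    set u : Fin m → ℂ := (ε : ℂ) • complexify e + complexify (v j) with hu
    have hfin := eval_ne_zero_of_homotopy (hh.1.map Complex.ofRealHom) (u := u)
      (Y := complexify y + ∑ i ∈ T, t i • complexify (v i)) (Z := s' • complexify e)
      ?_ ?_ ?_ (t j) (ht j)
    · rw [Finset.sum_insert hj]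
      convert hfin using 3
      rw [hu, hs']
      module
    · have := hh.eval_complex_plane (v j) ε 1
      rw [one_smul, ← hu] at this
      rw [this]
      refine mul_ne_zero he (Finset.prod_ne_zero_iff.2 fun i _ => ?_)
      have := hv j i
      rw [one_mul, ← Complex.ofReal_add]
      exact Complex.ofReal_ne_zero.2 (by positivity)
    · intro r hr x
      have := ih (r • y + x • v j) (s' + x * ε) (by simpa using hs'pos) (fun i => r * t i)
        (fun i => by simpa using mul_nonneg hr.1 (ht i))
      convert this using 3
      simp only [mul_smul, ← Finset.smul_sum]
      rw [complexify_add, complexify_smul, complexify_smul, hu]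
      module
    · intro x hx
      have h1 : s' • complexify e + x • u =
          (s' + x * ε) • complexify e + x • complexify (v j) := by
        ext k; simp [hu]; ring
      rw [h1, hh.eval_complex_plane]
      refine mul_ne_zero he (Finset.prod_ne_zero_iff.2 fun i _ h0 => ?_)
      have h2 := congrArg Complex.im h0
      have h3 := mul_nonneg hx (hv j i)
      have h4 := mul_nonneg hx hε.le
      simp at h2
      linarith

theorem IsHyperbolic.exists_eq_lam {m d : ℕ} {h : MvPolynomial (Fin m) ℝ} {e : Fin m → ℝ}
    {lam : (Fin m → ℝ) → Fin d → ℝ} (hh : IsHyperbolic h e lam) {x : Fin m → ℝ} {t : ℝ}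
    (ht : eval (t • e - x) h = 0) : ∃ i, t = lam x i := by
  rw [hh.2.2.2, mul_eq_zero, or_iff_right hh.2.1.ne', Finset.prod_eq_zero_iff] at ht
  obtain ⟨i, -, hi⟩ := ht
  exact ⟨i, sub_eq_zero.1 hi⟩

theorem IsHyperbolic.eval_lam {m d : ℕ} {h : MvPolynomial (Fin m) ℝ} {e : Fin m → ℝ}
    {lam : (Fin m → ℝ) → Fin d → ℝ} (hh : IsHyperbolic h e lam) (x : Fin m → ℝ) (i : Fin d) :
    eval (lam x i • e - x) h = 0 := by
  rw [hh.2.2.2, Finset.prod_eq_zero (Finset.mem_univ i) (sub_self _), mul_zero]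

theorem IsHyperbolic.inCone_add {m d : ℕ} {h : MvPolynomial (Fin m) ℝ} {e : Fin m → ℝ}
    {lam : (Fin m → ℝ) → Fin d → ℝ} (hh : IsHyperbolic h e lam) {w : Fin m → ℝ} {c : ℝ}
    (hc : ∀ i, |lam w i| ≤ c) : InCone lam (c • e + w) := by
  intro i
  have h1 := hh.eval_lam (c • e + w) i
  rw [show lam (c • e + w) i • e - (c • e + w) = (lam (c • e + w) i - c) • e - w by module] at h1
  obtain ⟨j, hj⟩ := hh.exists_eq_lam h1
  linarith [(abs_le.1 (hc j)).1]

theorem IsHyperbolic.inCone_sub {m d : ℕ} {h : MvPolynomial (Fin m) ℝ} {e : Fin m → ℝ}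
    {lam : (Fin m → ℝ) → Fin d → ℝ} (hh : IsHyperbolic h e lam) {w : Fin m → ℝ} {c : ℝ}
    (hc : ∀ i, |lam w i| ≤ c) : InCone lam (c • e - w) := by
  intro i
  have h1 := hh.eval_lam (c • e - w) i
  rw [show lam (c • e - w) i • e - (c • e - w) = (-1 : ℝ) • ((c - lam (c • e - w) i) • e - w) by
    module, hh.1.eval_smul_arg] at h1
  obtain ⟨j, hj⟩ := hh.exists_eq_lam ((mul_eq_zero.1 h1).resolve_left (by simp))
  linarith [(abs_le.1 (hc j)).2]

theorem IsHyperbolic.eval_plane {m d : ℕ} {h : MvPolynomial (Fin m) ℝ} {e : Fin m → ℝ}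
    {lam : (Fin m → ℝ) → Fin d → ℝ} (hh : IsHyperbolic h e lam) (v : Fin m → ℝ) (s t : ℝ) :
    eval (s • e + t • v) h = eval e h * ∏ i, (s + t * lam v i) := by
  have := hh.eval_complex_plane v s t
  rw [← complexify_smul, ← complexify_smul, ← complexify_add, eval_complexify] at this
  exact_mod_cast this

/-- If `c • e ± w` lie in the cone, then translating `w` along a cone vector `v` is dominated by
translating `(c + 1) • e`. -/
theorem IsHyperbolic.abs_eval_le {m d : ℕ} {h : MvPolynomial (Fin m) ℝ} {e : Fin m → ℝ}
    {lam : (Fin m → ℝ) → Fin d → ℝ} (hh : IsHyperbolic h e lam) {v w : Fin m → ℝ}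
    (hv : InCone lam v) {c : ℝ} (hc0 : 0 ≤ c) (hc : ∀ i, |lam w i| ≤ c) {t : ℝ} (ht : 0 ≤ t) :
    |eval (w + t • v) h| ≤ eval e h * ∏ i, (c + 1 + t * lam v i) := by
  have hH : (map Complex.ofRealHom h).IsHomogeneous d := hh.1.map _
  set a : Fin m → ℝ := (c + 1) • e + t • v with ha
  have haval : eval a h = eval e h * ∏ i, (c + 1 + t * lam v i) := hh.eval_plane v (c + 1) t
  have hapos : 0 < eval a h := by
    rw [haval]
    refine mul_pos hh.2.1 (Finset.prod_pos fun i _ => ?_)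
    have := mul_nonneg ht (hv i)
    linarith
  have hroot : ∀ s : ℂ, 1 < ‖s‖ →
      eval (complexify (w + t • v) + s • complexify a) (map Complex.ofRealHom h) ≠ 0 := by
    intro s hs h0
    have hre := (abs_le.1 (Complex.abs_re_le_norm s)).1
    have hre' := (abs_le.1 (Complex.abs_re_le_norm s)).2
    have hsq : s.re * s.re + s.im * s.im = ‖s‖ ^ 2 := by
      rw [Complex.sq_norm, Complex.normSq_apply]
    set k : ℂ := Complex.I * starRingEnd ℂ s with hk
    have hcone : ∀ i : Fin 3, InCone lam (![c • e + w, c • e - w, v] i) := by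
      intro i
      fin_cases i
      · exact hh.inCone_add hc
      · exact hh.inCone_sub hc
      · exact hv
    refine hh.eval_ne_zero hcone Finset.univ 0 (k * s) ?_
      ![k * (s + 1) / 2, k * (s - 1) / 2, k * (s + 1) * t] ?_ ?_
    · simp [hk]; nlinarith
    · have h1 : 0 ≤ (k * (s + 1)).im := by simp [hk]; nlinarith
      have h2 : 0 ≤ (k * (s - 1)).im := by simp [hk]; nlinarith
      intro i
      fin_cases i
      · simpa using div_nonneg h1 zero_le_two
      · simpa using div_nonneg h2 zero_le_two
      · simpa only [Fin.reduceFinMk, Matrix.cons_val, Complex.im_mul_ofReal] using mul_nonneg h1 ht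
    · rw [show complexify (0 : Fin m → ℝ) + (k * s) • complexify e + _ =
          k • (complexify (w + t • v) + s • complexify a) from ?_, hH.eval_smul_arg, h0, mul_zero]
      simp only [Fin.sum_univ_three, Matrix.cons_val]
      rw [ha]
      simp only [complexify_add, complexify_sub, complexify_smul]
      rw [show complexify (0 : Fin m → ℝ) = 0 by ext; simp [complexify]]
      push_cast
      module
  set P := linePoly (map Complex.ofRealHom h) (complexify (w + t • v)) (complexify a) with hP
  obtain ⟨hdeg, hco⟩ := natDegree_coeff_linePoly hH (complexify (w + t • v)) (complexify a)
  rw [eval_complexify, ← hP] at hco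
  have hane : ((eval a h : ℝ) : ℂ) ≠ 0 := Complex.ofReal_ne_zero.2 hapos.ne'
  have hnd : P.natDegree = d :=
    le_antisymm hdeg (Polynomial.le_natDegree_of_ne_zero (by rw [hco]; exact hane))
  have hP0 : P ≠ 0 := by
    rintro h0
    rw [h0, Polynomial.coeff_zero] at hco
    exact hane hco.symm
  have hprod : ∀ M : Multiset ℂ, (∀ ρ ∈ M, ‖ρ‖ ≤ 1) →
      ‖(M.map fun ρ => 0 - ρ).prod‖ ≤ 1 := by
    intro M
    induction M using Multiset.induction_on with
    | empty => simp
    | cons ρ M ih =>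
      intro hM
      rw [Multiset.map_cons, Multiset.prod_cons, norm_mul, zero_sub, norm_neg]
      exact mul_le_one₀ (hM ρ (Multiset.mem_cons_self _ _)) (norm_nonneg _)
        (ih fun ρ' h' => hM ρ' (Multiset.mem_cons_of_mem h'))
  have hval : P.eval 0 = (eval (w + t • v) h : ℂ) := by
    rw [hP, eval_linePoly, zero_smul, add_zero, eval_complexify]
  rw [(IsAlgClosed.splits P).eval_eq_prod_roots, Polynomial.leadingCoeff, hnd, hco] at hval
  rw [← haval, ← Real.norm_eq_abs, ← Complex.norm_real, ← hval, norm_mul, Complex.norm_real,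
    Real.norm_of_nonneg hapos.le]
  refine mul_le_of_le_one_right hapos.le (hprod _ fun ρ hρ => ?_)
  by_contra! hρ1
  refine hroot ρ hρ1 ?_
  rw [← eval_linePoly]
  exact (Polynomial.mem_roots hP0).1 hρ

theorem Polynomial.natDegree_le_of_abs_eval_le {q g : Polynomial ℝ} (hg : g ≠ 0)
    (h : ∀ t, 0 ≤ t → |q.eval t| ≤ |g.eval t|) : q.natDegree ≤ g.natDegree := by
  by_contra! hlt
  have hT := Polynomial.abs_div_tendsto_atTop_atTop_of_degree_gt q g
    (Polynomial.degree_lt_degree hlt) hg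
  obtain ⟨t, h1, h0⟩ :=
    ((hT.eventually_gt_atTop 1).and (Filter.eventually_ge_atTop (0 : ℝ))).exists
  rw [abs_div] at h1
  exact absurd (div_le_one_of_le₀ (h t h0) (abs_nonneg _)) (not_le.2 h1)

theorem IsHyperbolic.natDegree_linePoly_le {m d : ℕ} {h : MvPolynomial (Fin m) ℝ}
    {e : Fin m → ℝ} {lam : (Fin m → ℝ) → Fin d → ℝ} (hh : IsHyperbolic h e lam)
    {v : Fin m → ℝ} (hv : InCone lam v) (w : Fin m → ℝ) :
    (linePoly h w v).natDegree ≤ hrank lam v := by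
  set c : ℝ := ∑ i, |lam w i|
  have hc : ∀ i, |lam w i| ≤ c := fun i =>
    Finset.single_le_sum (f := fun i => |lam w i|) (fun _ _ => abs_nonneg _) (Finset.mem_univ i)
  have hc0 : 0 ≤ c := Finset.sum_nonneg fun _ _ => abs_nonneg _
  set g : Polynomial ℝ := Polynomial.C (eval e h) *
    ∏ i, (Polynomial.C (c + 1) + Polynomial.C (lam v i) * Polynomial.X) with hg
  have hgeval : ∀ t, g.eval t = eval e h * ∏ i, (c + 1 + t * lam v i) := fun t => by
    simp [hg, Polynomial.eval_prod, mul_comm t]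
  have hg0 : g ≠ 0 := by
    intro h0
    have := hgeval 0
    rw [h0] at this
    have h2 : 0 < eval e h * ∏ i : Fin d, (c + 1 + 0 * lam v i) :=
      mul_pos hh.2.1 (Finset.prod_pos fun i _ => by linarith)
    rw [← this] at h2
    simp at h2
  refine (Polynomial.natDegree_le_of_abs_eval_le hg0 fun t ht => ?_).trans ?_
  · rw [eval_linePoly, hgeval]
    exact (hh.abs_eval_le hv hc0 hc ht).trans (le_abs_self _)
  · refine (Polynomial.natDegree_C_mul_le _ _).trans ((Polynomial.natDegree_prod_le _ _).trans ?_)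
    rw [hrank, Nat.card_eq_fintype_card, Fintype.card_subtype, Finset.card_filter]
    refine Finset.sum_le_sum fun i _ => ?_
    split_ifs with hi
    · compute_degree
    · rw [not_not] at hi
      simp [hi]

/-- Nonvanishing when the first coordinate is in the open upper half-plane and the others are in
the closed upper half-plane. -/
def UpperStable {n : ℕ} (P : MvPolynomial (Fin (n + 1)) ℝ) : Prop :=
  ∀ z : Fin (n + 1) → ℂ, 0 < (z 0).im → (∀ i : Fin n, 0 ≤ (z i.succ).im) →
    eval z (map Complex.ofRealHom P) ≠ 0

theorem Polynomial.eval_zero_sub_mul_derivative_ne_zero {q : Polynomial ℂ}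
    (hq : ∀ t : ℂ, 0 ≤ t.im → q.eval t ≠ 0) (c : ℝ) :
    q.eval 0 - c * q.derivative.eval 0 ≠ 0 := by
  have h0 : q.eval 0 ≠ 0 := hq 0 le_rfl
  have hq0 : q ≠ 0 := by rintro rfl; simp at h0
  intro h
  have hsum := (IsAlgClosed.splits q).eval_derivative_div_eval_of_ne_zero h0
  have hneg : ∀ M : Multiset ℂ, (∀ ρ ∈ M, ρ.im < 0) → M ≠ 0 →
      ((M.map fun ρ => 1 / (0 - ρ)).sum).im < 0 := by
    intro M
    induction M using Multiset.induction_on with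
    | empty => simp
    | cons ρ M ih =>
      intro hM _
      have h1 : (1 / (0 - ρ)).im < 0 := by
        have hρ := hM ρ (Multiset.mem_cons_self _ _)
        have hρ0 : ρ ≠ 0 := by rintro rfl; simp at hρ
        rw [one_div, Complex.inv_im, zero_sub, Complex.neg_im, neg_neg, Complex.normSq_neg]
        exact div_neg_of_neg_of_pos hρ (Complex.normSq_pos.2 hρ0)
      rw [Multiset.map_cons, Multiset.sum_cons, Complex.add_im]
      by_cases hM0 : M = 0
      · subst hM0; simpa using h1
      · have := ih (fun ρ' h' => hM ρ' (Multiset.mem_cons_of_mem h')) hM0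
        linarith
  have hroots : ∀ ρ ∈ q.roots, ρ.im < 0 := fun ρ hρ => by
    by_contra! hlt
    exact hq ρ hlt ((Polynomial.mem_roots hq0).1 hρ)
  by_cases hr : q.roots = 0
  · rw [hr, Multiset.map_zero, Multiset.sum_zero, div_eq_zero_iff, or_iff_left h0] at hsum
    rw [hsum, mul_zero, sub_zero] at h
    exact h0 h
  · have him := hneg _ hroots hr
    rw [← hsum] at him
    have h1 : (c : ℂ) * (q.derivative.eval 0 / q.eval 0) = 1 := by
      rw [← mul_div_assoc, ← sub_eq_zero.1 h, div_self h0]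
    have h2 := congrArg Complex.im h1
    rw [Complex.im_ofReal_mul, Complex.one_im, mul_eq_zero, or_iff_left him.ne] at h2
    simp [h2] at h1

theorem UpperStable.sub_C_mul_pderiv {n : ℕ} {P : MvPolynomial (Fin (n + 1)) ℝ}
    (hP : UpperStable P) (c : ℝ) (i : Fin n) : UpperStable (P - C c * pderiv i.succ P) := by
  intro z hz0 hz
  set q := linePoly (map Complex.ofRealHom P) z (Pi.single i.succ 1) with hq
  have hne : ∀ t : ℂ, 0 ≤ t.im → q.eval t ≠ 0 := by
    intro t ht
    rw [hq, eval_linePoly]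
    refine hP _ ?_ fun j => ?_
    · simpa using hz0
    · by_cases hij : j = i
      · subst hij
        simpa using add_nonneg (hz j) ht
      · simpa [hij] using hz j
  have := Polynomial.eval_zero_sub_mul_derivative_ne_zero hne c
  rw [hq, derivative_linePoly, eval_linePoly, eval_linePoly, dirDeriv_single] at this
  simpa [pderiv_map] using this

theorem UpperStable.sub_half_pderiv_pderiv {n : ℕ} {P : MvPolynomial (Fin (n + 1)) ℝ}
    (hP : UpperStable P) (i : Fin n) :
    UpperStable (P - C (1 / 2 : ℝ) * pderiv i.succ (pderiv i.succ P)) := by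
  have h1 := (hP.sub_C_mul_pderiv (√(1 / 2)) i).sub_C_mul_pderiv (-√(1 / 2)) i
  have h2 : (C (√(1 / 2)) * C (√(1 / 2)) : MvPolynomial (Fin (n + 1)) ℝ) = C (1 / 2) := by
    rw [← C_mul, Real.mul_self_sqrt (by norm_num)]
  convert h1 using 1
  rw [← h2]
  simp only [map_sub, pderiv_C_mul, map_neg]
  ring

theorem UpperStable.opAll {n : ℕ} {P : MvPolynomial (Fin (n + 1)) ℝ} (hP : UpperStable P) :
    UpperStable (opAll P) := by
  unfold _root_.opAll
  generalize List.finRange n = L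
  induction L generalizing P with
  | nil => exact hP
  | cons i L ih => exact ih (hP.sub_half_pderiv_pderiv i)

theorem UpperStable.mul {n : ℕ} {P P' : MvPolynomial (Fin (n + 1)) ℝ} (hP : UpperStable P)
    (hP' : UpperStable P') : UpperStable (P * P') := fun z h0 hz => by
  rw [map_mul, map_mul]
  exact mul_ne_zero (hP z h0 hz) (hP' z h0 hz)

theorem eval_map_substPoly {m n : ℕ} {K : Type*} [CommRing K] (f : ℝ →+* K)
    (h : MvPolynomial (Fin m) ℝ) (e Q : Fin m → ℝ) (w : Fin n → Fin m → ℝ)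
    (z : Fin (n + 1) → K) :
    eval z (map f (substPoly h e Q w)) =
      eval (fun j => z 0 * f (e j) + f (Q j) + ∑ i : Fin n, z i.succ * f (w i j)) (map f h) := by
  unfold substPoly
  induction h using MvPolynomial.induction_on with
  | C r => simp
  | add p q hp hq => simp only [map_add, hp, hq]
  | mul_X p j hp =>
    simp only [map_mul, hp]
    simp

theorem IsHyperbolic.upperStable_substPoly {m d n : ℕ} {h : MvPolynomial (Fin m) ℝ}
    {e : Fin m → ℝ} {lam : (Fin m → ℝ) → Fin d → ℝ} (hh : IsHyperbolic h e lam)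
    {v : Fin n → Fin m → ℝ} (hv : ∀ i, InCone lam (v i)) {τ : Fin n → ℝ} (hτ : ∀ i, 0 ≤ τ i)
    (Q : Fin m → ℝ) : UpperStable (substPoly h e Q fun i => τ i • v i) := by
  intro z h0 hz
  rw [eval_map_substPoly]
  have := hh.eval_ne_zero hv Finset.univ Q (z 0) h0 (fun i => z i.succ * τ i)
    fun i => by simpa using mul_nonneg (hz i) (hτ i)
  have hpt : (fun j => z 0 * Complex.ofRealHom (e j) + Complex.ofRealHom (Q j) +
      ∑ i : Fin n, z i.succ * Complex.ofRealHom ((τ i • v i) j)) =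
      complexify Q + z 0 • complexify e + ∑ i, (z i.succ * τ i) • complexify (v i) := by
    funext j
    simp [complexify, mul_assoc, add_comm]
  rw [hpt]
  exact this

theorem UpperStable.realRooted_toUni {n : ℕ} {P : MvPolynomial (Fin (n + 1)) ℝ}
    (hP : UpperStable P) : RealRooted (toUni P) := by
  have haeval : ∀ z : ℂ, Polynomial.aeval z (toUni P) =
      eval (Fin.cons z fun _ => 0) (map Complex.ofRealHom P) := by
    intro z
    unfold toUni
    clear hP
    induction P using MvPolynomial.induction_on with
    | C r => simp
    | add p q hp hq => simp only [map_add, hp, hq]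
    | mul_X p j hp =>
      simp only [map_mul, aeval_X, hp, map_X, eval_X]
      congr 1
      cases j using Fin.cases <;> simp
  have hup : ∀ z : ℂ, 0 < z.im → Polynomial.aeval z (toUni P) ≠ 0 := fun z hz => by
    rw [haeval]
    exact hP _ (by simpa using hz) (by simp)
  intro z hz
  by_contra him
  rcases lt_or_gt_of_ne him with h | h
  · refine hup (starRingEnd ℂ z) (by simpa using h) ?_
    rw [Polynomial.aeval_conj, hz, map_zero]
  · exact hup z h hz

theorem pderiv_succ_substPoly {m n : ℕ} (a : MvPolynomial (Fin m) ℝ) (e Q : Fin m → ℝ)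
    (w : Fin n → Fin m → ℝ) (i : Fin n) :
    pderiv i.succ (substPoly a e Q w) = substPoly (dirDeriv (w i) a) e Q w := by
  unfold substPoly
  induction a using MvPolynomial.induction_on with
  | C r => simp [dirDeriv]
  | add p q hp hq => simp only [map_add, hp, hq]
  | mul_X p j hp =>
    have hX : pderiv i.succ (X (0 : Fin (n + 1)) * C (e j) + C (Q j) +
        ∑ k : Fin n, X k.succ * C (w k j)) = (C (w i j) : MvPolynomial (Fin (n + 1)) ℝ) := by
      have h0 : pderiv i.succ (X (0 : Fin (n + 1)) : MvPolynomial (Fin (n + 1)) ℝ) = 0 :=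
        pderiv_X_of_ne (Fin.succ_ne_zero i).symm
      have hk : ∀ k : Fin n, pderiv i.succ (X k.succ * C (w k j)) =
          if k = i then (C (w k j) : MvPolynomial (Fin (n + 1)) ℝ) else 0 := fun k => by
        split_ifs with hki
        · subst hki; simp
        · have : pderiv i.succ (X k.succ : MvPolynomial (Fin (n + 1)) ℝ) = 0 :=
            pderiv_X_of_ne fun h => hki (Fin.succ_injective _ h)
          simp [this]
      rw [map_add, map_add, map_sum]
      simp [h0, hk]
    have hD : dirDeriv (w i) (X j) = C (w i j) := mkDerivation_X _ _ _
    simp only [map_mul, aeval_X, Derivation.leibniz, smul_eq_mul, hX, hD, hp, map_add, algHom_C]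
    rfl

theorem eval_cons_zero_substPoly {m n : ℕ} (a : MvPolynomial (Fin m) ℝ) (e Q : Fin m → ℝ)
    (w : Fin n → Fin m → ℝ) (x : ℝ) :
    eval (Fin.cons x fun _ => (0 : ℝ)) (substPoly a e Q w) = eval (x • e + Q) a := by
  have := eval_map_substPoly (RingHom.id ℝ) a e Q w (Fin.cons x fun _ => (0 : ℝ))
  rw [map_id, map_id] at this
  rw [this]
  congr 2
  funext j
  simp

/-- The bilinear form `(a, b) ↦ ∏ k, (1 - c k * (D (v k) ⊗ D (v k))) (a ⊗ b)`, evaluated at the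
pair of points `(y₁, y₂)`. -/
def dirDerivPairing {m : ℕ} (y₁ y₂ : Fin m → ℝ) : List ((Fin m → ℝ) × ℝ) →
    MvPolynomial (Fin m) ℝ →ₗ[ℝ] MvPolynomial (Fin m) ℝ →ₗ[ℝ] ℝ
  | [] => (LinearMap.mul ℝ ℝ).compl₁₂ (aeval y₁).toLinearMap (aeval y₂).toLinearMap
  | q :: L => dirDerivPairing y₁ y₂ L - q.2 • (dirDerivPairing y₁ y₂ L).compl₁₂
      (dirDeriv q.1).toLinearMap (dirDeriv q.1).toLinearMap

theorem dirDerivPairing_nil {m : ℕ} (y₁ y₂ : Fin m → ℝ) (a b : MvPolynomial (Fin m) ℝ) :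
    dirDerivPairing y₁ y₂ [] a b = eval y₁ a * eval y₂ b := by
  simp [dirDerivPairing]

theorem dirDerivPairing_cons {m : ℕ} (y₁ y₂ : Fin m → ℝ) (q : (Fin m → ℝ) × ℝ)
    (L : List ((Fin m → ℝ) × ℝ)) (a b : MvPolynomial (Fin m) ℝ) :
    dirDerivPairing y₁ y₂ (q :: L) a b = dirDerivPairing y₁ y₂ L a b -
      q.2 * dirDerivPairing y₁ y₂ L (dirDeriv q.1 a) (dirDeriv q.1 b) := rfl

theorem dirDerivPairing_smul_vectors {m : ℕ} {ι : Type*} (y₁ y₂ : Fin m → ℝ)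
    (v : ι → Fin m → ℝ) (τ : ι → ℝ) (L : List ι) (a b : MvPolynomial (Fin m) ℝ) :
    dirDerivPairing y₁ y₂ (L.map fun i => (τ i • v i, 1)) a b =
      dirDerivPairing y₁ y₂ (L.map fun i => (v i, τ i ^ 2)) a b := by
  induction L generalizing a b with
  | nil => rfl
  | cons i L ih =>
    simp only [List.map_cons, dirDerivPairing_cons, ih, dirDeriv_smul, map_smul,
      LinearMap.smul_apply, smul_eq_mul]
    ring

theorem dirDerivPairing_add_smul {m : ℕ} (L : List ((Fin m → ℝ) × ℝ)) {v : Fin m → ℝ}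
    {a b : MvPolynomial (Fin m) ℝ} (ha : dirDeriv v (dirDeriv v a) = 0)
    (hb : dirDeriv v (dirDeriv v b) = 0) (y₁ y₂ : Fin m → ℝ) (s t : ℝ) :
    dirDerivPairing (y₁ + s • v) (y₂ + t • v) L a b =
      dirDerivPairing y₁ y₂ L (a + s • dirDeriv v a) (b + t • dirDeriv v b) := by
  induction L generalizing a b with
  | nil =>
    rw [dirDerivPairing_nil, dirDerivPairing_nil, eval_add_smul_of_dirDeriv_eq_zero ha,
      eval_add_smul_of_dirDeriv_eq_zero hb, map_add, map_add, smul_eval, smul_eval]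
  | cons q L ih =>
    have hc : ∀ {c : MvPolynomial (Fin m) ℝ}, dirDeriv v (dirDeriv v c) = 0 →
        dirDeriv v (dirDeriv v (dirDeriv q.1 c)) = 0 := fun {c} h => by
      rw [dirDeriv_comm v q.1, dirDeriv_comm v q.1, h, map_zero]
    rw [dirDerivPairing_cons, dirDerivPairing_cons, ih ha hb, ih (hc ha) (hc hb)]
    rw [dirDeriv_comm v q.1 a, dirDeriv_comm v q.1 b]
    simp only [map_add, Derivation.map_smul]

theorem foldl_sub_pderiv_sub {n : ℕ} (L : List (Fin n)) (P P' : MvPolynomial (Fin (n + 1)) ℝ) :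
    L.foldl (fun Q i => Q - C (1 / 2 : ℝ) * pderiv i.succ (pderiv i.succ Q)) (P - P') =
      L.foldl (fun Q i => Q - C (1 / 2 : ℝ) * pderiv i.succ (pderiv i.succ Q)) P -
      L.foldl (fun Q i => Q - C (1 / 2 : ℝ) * pderiv i.succ (pderiv i.succ Q)) P' := by
  induction L generalizing P P' with
  | nil => rfl
  | cons i L ih =>
    rw [List.foldl_cons, List.foldl_cons, List.foldl_cons, ← ih]
    congr 1
    simp only [map_sub]
    ring

theorem eval_foldl_substPoly_mul {m n : ℕ} (e Q Q' : Fin m → ℝ) (w : Fin n → Fin m → ℝ)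
    (x : ℝ) (L : List (Fin n)) {a b : MvPolynomial (Fin m) ℝ}
    (ha : ∀ i, dirDeriv (w i) (dirDeriv (w i) a) = 0)
    (hb : ∀ i, dirDeriv (w i) (dirDeriv (w i) b) = 0) :
    eval (Fin.cons x fun _ => (0 : ℝ))
      (L.foldl (fun P i => P - C (1 / 2 : ℝ) * pderiv i.succ (pderiv i.succ P))
        (substPoly a e Q w * substPoly b e Q' w)) =
      dirDerivPairing (x • e + Q) (x • e + Q') (L.map fun i => (w i, 1)) a b := by
  induction L generalizing a b with
  | nil => simp [dirDerivPairing_nil, eval_cons_zero_substPoly]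
  | cons i L ih =>
    have hstep : substPoly a e Q w * substPoly b e Q' w - C (1 / 2 : ℝ) *
        pderiv i.succ (pderiv i.succ (substPoly a e Q w * substPoly b e Q' w)) =
        substPoly a e Q w * substPoly b e Q' w -
          substPoly (dirDeriv (w i) a) e Q w * substPoly (dirDeriv (w i) b) e Q' w := by
      have h0 : ∀ R, substPoly (0 : MvPolynomial (Fin m) ℝ) e R w = 0 := fun R => by
        simp [substPoly]
      have h2 : (C (1 / 2 : ℝ) * 2 : MvPolynomial (Fin (n + 1)) ℝ) = 1 := by
        rw [show (2 : MvPolynomial (Fin (n + 1)) ℝ) = C 2 from rfl, ← C_mul]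
        norm_num
      simp only [Derivation.leibniz, smul_eq_mul, map_add, pderiv_succ_substPoly, ha, hb, h0]
      linear_combination (-substPoly (dirDeriv (w i) a) e Q w *
        substPoly (dirDeriv (w i) b) e Q' w) * h2
    have hc : ∀ {c : MvPolynomial (Fin m) ℝ}, (∀ j, dirDeriv (w j) (dirDeriv (w j) c) = 0) →
        ∀ j, dirDeriv (w j) (dirDeriv (w j) (dirDeriv (w i) c)) = 0 := fun {c} h j => by
      rw [dirDeriv_comm (w j) (w i), dirDeriv_comm (w j) (w i), h, map_zero]
    rw [List.foldl_cons, hstep, foldl_sub_pderiv_sub, map_sub, ih ha hb, ih (hc ha) (hc hb),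
      List.map_cons, dirDerivPairing_cons, one_mul]

theorem sum_piFinset_succ {n : ℕ} (S : Fin (n + 1) → Finset ℝ) (f : (Fin (n + 1) → ℝ) → ℝ) :
    ∑ s ∈ Fintype.piFinset S, f s =
      ∑ c ∈ S 0, ∑ r ∈ Fintype.piFinset fun i : Fin n => S i.succ, f (Fin.cons c r) := by
  rw [← Finset.sum_product']
  refine Finset.sum_nbij' (fun s => (s 0, Fin.tail s)) (fun q => Fin.cons q.1 q.2) ?_ ?_ ?_ ?_ ?_
  · intro s hs
    rw [Fintype.mem_piFinset] at hs
    simp [Fin.tail, hs]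
  · rintro ⟨c, r⟩ hq
    rw [Finset.mem_product, Fintype.mem_piFinset] at hq
    rw [Fintype.mem_piFinset]
    exact Fin.cases hq.1 hq.2
  · intro s _
    simp
  · intro q _
    simp
  · intro s _
    simp

theorem sum_piFinset_eval_mul_eval {m n : ℕ} (v : Fin n → Fin m → ℝ)
    {a b : MvPolynomial (Fin m) ℝ} (ha : ∀ i, dirDeriv (v i) (dirDeriv (v i) a) = 0)
    (hb : ∀ i, dirDeriv (v i) (dirDeriv (v i) b) = 0)
    (S : Fin n → Finset ℝ) (p : Fin n → ℝ → ℝ) (hp1 : ∀ i, ∑ c ∈ S i, p i c = 1)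
    (μ τ : Fin n → ℝ) (hμ : ∀ i, μ i = ∑ c ∈ S i, p i c * c)
    (hτ : ∀ i, τ i ^ 2 = ∑ c ∈ S i, p i c * (c - μ i) ^ 2) (y₁ y₂ : Fin m → ℝ) :
    ∑ s ∈ Fintype.piFinset S, (∏ i, p i (s i)) *
        (eval (y₁ - ∑ i, (s i - μ i) • v i) a * eval (y₂ + ∑ i, (s i - μ i) • v i) b) =
      dirDerivPairing y₁ y₂ ((List.finRange n).map fun i => (v i, τ i ^ 2)) a b := by
  induction n generalizing y₁ y₂ with
  | zero => simp [dirDerivPairing_nil]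
  | succ n ih =>
    rw [sum_piFinset_succ, List.finRange_succ, List.map_cons, List.map_map, dirDerivPairing_cons]
    set L := (List.finRange n).map ((fun i => (v i, τ i ^ 2)) ∘ Fin.succ) with hL
    have hinner : ∀ c, ∑ r ∈ Fintype.piFinset fun i : Fin n => S i.succ,
        (∏ i, p i ((Fin.cons c r : Fin (n + 1) → ℝ) i)) *
          (eval (y₁ - ∑ i, ((Fin.cons c r : Fin (n + 1) → ℝ) i - μ i) • v i) a *
            eval (y₂ + ∑ i, ((Fin.cons c r : Fin (n + 1) → ℝ) i - μ i) • v i) b) =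
        p 0 c * dirDerivPairing y₁ y₂ L a b +
          p 0 c * (c - μ 0) * (dirDerivPairing y₁ y₂ L a (dirDeriv (v 0) b) -
            dirDerivPairing y₁ y₂ L (dirDeriv (v 0) a) b) -
          p 0 c * (c - μ 0) ^ 2 *
            dirDerivPairing y₁ y₂ L (dirDeriv (v 0) a) (dirDeriv (v 0) b) := by
      intro c
      have h1 := ih (fun i : Fin n => v i.succ) (fun i : Fin n => ha i.succ)
        (fun i : Fin n => hb i.succ) (fun i : Fin n => S i.succ) (fun i : Fin n => p i.succ)
        (fun i : Fin n => hp1 i.succ) (fun i : Fin n => μ i.succ) (fun i : Fin n => τ i.succ)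
        (fun i : Fin n => hμ i.succ) (fun i : Fin n => hτ i.succ)
        (y₁ + (-(c - μ 0)) • v 0) (y₂ + (c - μ 0) • v 0)
      rw [dirDerivPairing_add_smul _ (ha 0) (hb 0)] at h1
      have h2 : ((List.finRange n).map fun i => (v i.succ, τ i.succ ^ 2)) = L := rfl
      rw [h2] at h1
      simp only [map_add, map_smul, LinearMap.add_apply, LinearMap.smul_apply, smul_eq_mul] at h1
      trans p 0 c * ∑ r ∈ Fintype.piFinset fun i : Fin n => S i.succ, (∏ i : Fin n, p i.succ (r i)) *
        (eval (y₁ + (-(c - μ 0)) • v 0 - ∑ i : Fin n, (r i - μ i.succ) • v i.succ) a *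
          eval (y₂ + (c - μ 0) • v 0 + ∑ i : Fin n, (r i - μ i.succ) • v i.succ) b)
      · rw [Finset.mul_sum]
        refine Finset.sum_congr rfl fun r _ => ?_
        simp only [Fin.prod_univ_succ, Fin.sum_univ_succ, Fin.cons_zero, Fin.cons_succ]
        rw [show y₁ + (-(c - μ 0)) • v 0 - ∑ i : Fin n, (r i - μ i.succ) • v i.succ =
          y₁ - ((c - μ 0) • v 0 + ∑ i : Fin n, (r i - μ i.succ) • v i.succ) by module, add_assoc y₂]
        ring
      · rw [h1]
        ring
    have hmean : ∑ c ∈ S 0, p 0 c * (c - μ 0) = 0 := by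
      simp only [mul_sub, Finset.sum_sub_distrib, ← Finset.sum_mul, hp1, ← hμ]
      ring
    simp only [hinner]
    rw [Finset.sum_sub_distrib, Finset.sum_add_distrib, ← Finset.sum_mul, ← Finset.sum_mul,
      ← Finset.sum_mul, hp1, hmean, ← hτ]
    ring

/-- The mixed characteristic polynomial equals the multivariate polynomial with the
second-derivative operators applied and `z = 0`; moreover it is real-rooted in `x`. -/
theorem kls_expectation_identity
    {m d n : ℕ} (h : MvPolynomial (Fin m) ℝ) (e : Fin m → ℝ)
    (lam : (Fin m → ℝ) → Fin d → ℝ)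
    (hhyp : IsHyperbolic h e lam) (he : InOpenCone lam e)
    (v : Fin n → Fin m → ℝ)
    (hv : ∀ i, InCone lam (v i))
    (hvrank : ∀ i, hrank lam (v i) ≤ 1)
    (S : Fin n → Finset ℝ) (p : Fin n → ℝ → ℝ)
    (hS : ∀ i, (S i).Nonempty)
    (hp : ∀ i, ∀ a ∈ S i, 0 < p i a)
    (hp1 : ∀ i, ∑ a ∈ S i, p i a = 1)
    (μ τ : Fin n → ℝ)
    (hμ : ∀ i, μ i = ∑ a ∈ S i, p i a * a)
    (hτ0 : ∀ i, 0 ≤ τ i)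
    (hτ : ∀ i, τ i ^ 2 = ∑ a ∈ S i, p i a * (a - μ i) ^ 2)
    (Q : Fin m → ℝ) :
    (∀ x : ℝ,
      ∑ s ∈ Fintype.piFinset S, (∏ i, p i (s i)) *
        (eval (x • e - (Q + ∑ i, (s i - μ i) • v i)) h *
          eval (x • e + (Q + ∑ i, (s i - μ i) • v i)) h)
      = eval (Fin.cons x fun _ => (0 : ℝ)) (mixedPoly h e Q fun i => τ i • v i))
    ∧ RealRooted (toUni (mixedPoly h e Q fun i => τ i • v i)) := by
  have hh : ∀ i, dirDeriv (v i) (dirDeriv (v i) h) = 0 := fun i =>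
    dirDeriv_dirDeriv_eq_zero fun y => (hhyp.natDegree_linePoly_le (hv i) y).trans (hvrank i)
  refine ⟨fun x => ?_, ?_⟩
  · have hh' : ∀ i, dirDeriv (τ i • v i) (dirDeriv (τ i • v i) h) = 0 := fun i => by
      rw [dirDeriv_smul, dirDeriv_smul, Derivation.map_smul, hh, smul_zero, smul_zero]
    rw [mixedPoly, opAll, eval_foldl_substPoly_mul e (-Q) Q _ x _ hh' hh',
      dirDerivPairing_smul_vectors, ← sum_piFinset_eval_mul_eval v hh hh S p hp1 μ τ hμ hτ]
    refine Finset.sum_congr rfl fun s _ => ?_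
    rw [add_assoc, ← sub_eq_add_neg, sub_sub]
  · exact ((hhyp.upperStable_substPoly hv hτ0 (-Q)).mul
      (hhyp.upperStable_substPoly hv hτ0 Q)).opAll.realRooted_toUni
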